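/- Let Λ be an Eulerian lattice of rank n and ν∈Λ with ν > 0̂. Then the ab-index of the semisuspension Λ_ν′ is given by Ψ_{Λ_ν′} = Σ_{ν ≤ π < 1̂} Ψ_{[0̂,π)} · α_{ρ(π,1̂)}, where the cd-polynomials α_k are evaluated by substituting c = a+b and d = ab+ba, and the sum is over all π∈Λ with π ≥ ν. -/

import Mathlib

open scoped Classical

noncomputable section

/-- The ring of polynomials in two non-commuting variables `a`, `b` (with rational
coefficients), in which `ab`-indices and `cd`-indices live. -/
abbrev NC := FreeAlgebra ℚ (Fin 2)

/-- The variable `a`. -/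
def va : NC := FreeAlgebra.ι ℚ 0
/-- The variable `b`. -/
def vb : NC := FreeAlgebra.ι ℚ 1
/-- `c = a + b`. -/
def vc : NC := va + vb
/-- `d = ab + ba`. -/
def vd : NC := va * vb + vb * va

/-- A `cd`-monomial, encoded as a list of booleans (`false` = `c`, `true` = `d`),
viewed inside `NC` via `c = a+b`, `d = ab+ba`. -/
def cdMonomial : List Bool → NC
  | [] => 1
  | s :: w => (if s then vd else vc) * cdMonomial w

/-- Degree of a `cd`-monomial (`c` has degree 1, `d` has degree 2). -/
def cdDeg (w : List Bool) : ℕ := (w.map fun s => if s then 2 else 1).sum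

/-- Evaluation of an integer combination of `cd`-monomials in `NC`. -/
def cdEval (f : List Bool →₀ ℤ) : NC := f.sum fun w z => (z : ℚ) • cdMonomial w

/-- The weight of a chain, computed from the (strictly increasing) list of absolute ranks
of its elements; `N` is the absolute rank of the (possibly formal) maximal element `1̂`.
For a list `[r₀, r₁, …, r_k]` this is
`(a-b)^(r₁-r₀-1) · b · (a-b)^(r₂-r₁-1) · b ⋯ b · (a-b)^(N-1-r_k)`. -/
def wtRanks (N : ℕ) : List ℕ → NC
  | [] => 1
  | [r] => (va - vb) ^ (N - 1 - r)
  | r :: s :: l => (va - vb) ^ (s - r - 1) * vb * wtRanks N (s :: l)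


/-- A finite type has a finite `WithTop`. -/
instance {α : Type*} [Fintype α] : Fintype (WithTop α) := inferInstanceAs (Fintype (Option α))

/-- A lexicographic sum of finite types is finite. -/
instance {α β : Type*} [Fintype α] [Fintype β] : Fintype (α ⊕ₗ β) :=
  inferInstanceAs (Fintype (α ⊕ β))

section Posets

variable {P : Type*} [Fintype P] [PartialOrder P]

/-- `y` is a chain of the subposet `S ⊆ P` whose minimal element is `m`, containing `m`
(chains of a poset always contain the minimal element `0̂ = m`). -/
def chainIn (S : Set P) (m : P) (y : Finset P) : Prop :=
  m ∈ y ∧ ↑y ⊆ S ∧ IsChain (· < ·) (↑y : Set P)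

/-- The `ab`-index `Ψ` of the subposet `S ⊆ P` with minimal element `m`, of rank `n`
(so the adjoined maximal element `1̂` has absolute rank `rk m + n + 1`); ranks of
elements are computed by the ambient rank function `rk`. -/
def absIndexOn (S : Set P) (m : P) (rk : P → ℕ) (n : ℕ) : NC :=
  ∑ y : Finset P,
    if chainIn S m y then wtRanks (rk m + n + 1) ((y.image rk).sort (· ≤ ·)) else 0

/-- The simplicial boundary operator relative to a chain `x`: a chain `y ⊇ x` is sent to
the signed sum of the chains `y ∖ {σ}` for `σ ∈ y ∖ x`, the sign of `σ` being determined
by its position in `y`.  Together with the grading by cardinality, this is the cellular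
(chain) complex of the order complex computing (relative) simplicial homology. -/
def bnd (x : Finset P) : (Finset P →₀ ℝ) →ₗ[ℝ] (Finset P →₀ ℝ) :=
  Finsupp.lsum ℝ fun y => LinearMap.id.smulRight
    (∑ σ ∈ y \ x, ((-1 : ℝ) ^ (y.filter fun τ => τ < σ).card) • Finsupp.single (y.erase σ) (1 : ℝ))

/-- The degree-`k` term of the cellular complex of (the order complex of) the subposet
`S` with minimal element `m`, relative to the chain `x`: the span of all chains `y ⊇ x`
in `S` with `k` elements. -/
def cellSpace (S : Set P) (m : P) (x : Finset P) (k : ℕ) : Submodule ℝ (Finset P →₀ ℝ) :=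
  Submodule.span ℝ
    {f | ∃ y : Finset P, chainIn S m y ∧ x ⊆ y ∧ y.card = k ∧ f = Finsupp.single y 1}

/-- The homological Gorenstein condition for the subposet `S ⊆ P` with minimal element
`m`, of rank `n`: the order complex is a real homology sphere, i.e. for every chain `x`
the cellular complex of the interval `[x, 1̂)` of the order complex is exact except at the
top (chains of `n+1` elements), where the homology is 1-dimensional. -/
def GorensteinOn (S : Set P) (m : P) (n : ℕ) : Prop :=
  ∀ x : Finset P, chainIn S m x → ∀ k : ℕ,
    Module.finrank ℝ ↥(LinearMap.ker (bnd x) ⊓ cellSpace S m x k) =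
      Module.finrank ℝ ↥(Submodule.map (bnd x) (cellSpace S m x (k + 1))) +
        (if k = n + 1 then 1 else 0)

/-- `S ⊆ P` is a graded (sub)poset of rank `n` with minimal element `m`: covers in `S`
increase the ambient rank `rk` by one, and all maximal elements of `S` have rank
`rk m + n`. -/
def IsGradedOn (S : Set P) (m : P) (rk : P → ℕ) (n : ℕ) : Prop :=
  m ∈ S ∧ (∀ x ∈ S, m ≤ x) ∧
    (∀ a ∈ S, ∀ b ∈ S, a < b → (¬ ∃ c ∈ S, a < c ∧ c < b) → rk b = rk a + 1) ∧
    (∀ a ∈ S, (∀ b ∈ S, ¬ a < b) → rk a = rk m + n)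

/-- `S ⊆ P` (with minimal element `m` and ambient rank function `rk`) is a Gorenstein*
poset of rank `n`. -/
def IsGorensteinStarOn (S : Set P) (m : P) (rk : P → ℕ) (n : ℕ) : Prop :=
  IsGradedOn S m rk n ∧ GorensteinOn S m n

/-- The pair `(S, B)` (with minimal element `m` and ambient rank function `rk`) is a
near-Gorenstein* poset of rank `n` with boundary `B`: `B` is an order ideal of `S` of
rank `n-1` which is Gorenstein* of rank `n-1`, and the order complex of `S` is a real
homology ball with boundary the order complex of `B`: for every chain `x` of `S`, the
cellular complex of `[x, 1̂)` is exact, except that when `x` is not a chain of `B` the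
homology at the top is 1-dimensional. -/
def IsNearGorensteinStarOn (S B : Set P) (m : P) (rk : P → ℕ) (n : ℕ) : Prop :=
  IsGradedOn S m rk n ∧ B ⊆ S ∧ (∀ σ ∈ B, ∀ τ ∈ S, τ ≤ σ → τ ∈ B) ∧
    IsGradedOn B m rk (n - 1) ∧ GorensteinOn B m (n - 1) ∧
    ∀ x : Finset P, chainIn S m x → ∀ k : ℕ,
      Module.finrank ℝ ↥(LinearMap.ker (bnd x) ⊓ cellSpace S m x k) =
        Module.finrank ℝ ↥(Submodule.map (bnd x) (cellSpace S m x (k + 1))) +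
          (if k = n + 1 ∧ ¬(↑x ⊆ B) then 1 else 0)

end Posets

end

/-- The `cd`-polynomials `α_k` of Billera–Ehrenborg: `α₀ = -1`,
`α_{2k} = -(1/2)[(c²-2d)^k + c(c²-2d)^{k-1}c]` and
`α_{2k+1} = (1/2)[(c²-2d)^k c + c(c²-2d)^k]`. -/
def alphaPoly : ℕ → NC
  | 0 => -1
  | k + 1 =>
    if (k + 1) % 2 = 0 then
      -((2 : ℚ)⁻¹ • ((vc ^ 2 - 2 * vd) ^ ((k + 1) / 2) +
        vc * (vc ^ 2 - 2 * vd) ^ ((k + 1) / 2 - 1) * vc))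
    else
      (2 : ℚ)⁻¹ • ((vc ^ 2 - 2 * vd) ^ ((k + 1) / 2) * vc +
        vc * (vc ^ 2 - 2 * vd) ^ ((k + 1) / 2))

theorem wtRanks_append_singleton (N r : ℕ) :
    ∀ l : List ℕ, l ≠ [] →
      wtRanks N (l ++ [r]) = wtRanks r l * vb * (va - vb) ^ (N - 1 - r)
  | [], h => absurd rfl h
  | [s], _ => by simp only [List.cons_append, List.nil_append, wtRanks, Nat.sub_right_comm]
  | s :: t :: l, _ => by
    have ih := wtRanks_append_singleton N r (t :: l) (by simp)
    simp only [List.cons_append, wtRanks] at ih ⊢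
    rw [ih]
    simp only [mul_assoc]

theorem alphaPoly_succ (k : ℕ) :
    alphaPoly (k + 1) = (-1 : ℤ) ^ k • ((va - vb) ^ k * ((va - vb) + vb)) +
      vb * (if Even k then (va - vb) ^ k else -((va - vb) ^ (k - 1) * vc)) := by
  have hsq : vc ^ 2 - 2 * vd = (va - vb) ^ 2 := by
    simp only [vc, vd]; noncomm_ring
  have hc : vc = (va - vb) + (2 : ℚ) • vb := by
    rw [two_smul, vc]; abel
  have hcomm (m : ℕ) : (va - vb) * (va - vb) ^ m = (va - vb) ^ m * (va - vb) :=
    (pow_succ' _ _).symm.trans (pow_succ _ _)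
  rcases Nat.even_or_odd k with hk | hk
  · obtain ⟨m, rfl⟩ := hk
    have h1 : (m + m + 1) % 2 ≠ 0 := by omega
    have h2 : (m + m + 1) / 2 = m := by omega
    have hev : Even (m + m) := ⟨m, rfl⟩
    rw [alphaPoly, if_neg h1, h2, hsq, ← pow_mul, two_mul, if_pos hev, hev.neg_one_pow, hc]
    generalize hm : m + m = p
    simp only [mul_add, add_mul, hcomm, smul_add, mul_smul_comm, smul_mul_assoc, smul_smul,
      one_smul]
    norm_num
    module
  · obtain ⟨m, rfl⟩ := hk
    have h1 : (2 * m + 1 + 1) % 2 = 0 := by omega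
    have h2 : (2 * m + 1 + 1) / 2 = m + 1 := by omega
    have hodd : Odd (2 * m + 1) := ⟨m, rfl⟩
    rw [alphaPoly, if_pos h1, h2, hsq, ← pow_mul, ← pow_mul,
      if_neg (Nat.not_even_iff_odd.2 hodd), hodd.neg_one_pow, hc]
    have h3 : 2 * (m + 1) = 2 * m + 1 + 1 := by ring
    simp only [Nat.add_sub_cancel, h3]
    generalize 2 * m = p
    simp only [pow_succ, mul_add, add_mul, hcomm, smul_add, mul_smul_comm, smul_mul_assoc,
      smul_smul, neg_smul, one_smul, ← mul_assoc, mul_neg]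
    norm_num
    module

theorem chainIn.exists_isGreatest {P : Type*} [PartialOrder P] [OrderBot P]
    {S : Set P} {y : Finset P} (h : chainIn S ⊥ y) :
    ∃ σ, IsGreatest (y : Set P) σ := by
  obtain ⟨σ, hσ⟩ := y.exists_maximal ⟨⊥, h.1⟩
  refine ⟨σ, hσ.1, fun x hx => ?_⟩
  rcases eq_or_ne x σ with rfl | hne
  · exact le_rfl
  · exact (h.2.2 hx hσ.1 hne).elim le_of_lt fun hlt => absurd hlt (hσ.not_gt hx)

theorem sort_image_insert {P : Type*} [PartialOrder P] {rk : P → ℕ} (hrk : StrictMono rk)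
    {σ : P} {y : Finset P} (hy : (y : Set P) ⊆ {x | x < σ}) :
    ((insert σ y).image rk).sort (· ≤ ·) = (y.image rk).sort (· ≤ ·) ++ [rk σ] := by
  have hlt : ∀ r ∈ y.image rk, r < rk σ := by
    intro r hr
    obtain ⟨x, hx, rfl⟩ := Finset.mem_image.1 hr
    exact hrk (hy hx)
  refine List.Perm.eq_of_pairwise' (r := (· ≤ ·)) (Finset.pairwise_sort _ _) ?_ ?_
  · refine List.pairwise_append.2 ⟨Finset.pairwise_sort _ _, by simp, fun a ha b hb => ?_⟩
    rw [List.mem_singleton.1 hb]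
    exact (hlt a ((Finset.mem_sort _).1 ha)).le
  · refine (List.perm_ext_iff_of_nodup (Finset.sort_nodup _ _) ?_).2 fun a => ?_
    · refine List.nodup_append.2 ⟨Finset.sort_nodup _ _, by simp, fun a ha b hb => ?_⟩
      rw [List.mem_singleton.1 hb]
      exact (hlt a ((Finset.mem_sort _).1 ha)).ne
    · simp [or_comm]

theorem sum_withTop {α M : Type*} [Fintype α] [AddCommMonoid M] (f : WithTop α → M) :
    ∑ z, f z = f ⊤ + ∑ x : α, f x :=
  Fintype.sum_option (α := α) f

/-- The Eulerian relation for the upper interval `[τ, 1̂]`, with the term of `1̂` separated. -/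
theorem upper_interval_sum_of_eulerian {P : Type*} [Fintype P] [PartialOrder P]
    {rk : P → ℕ} {n : ℕ} (heul : ∀ x y : WithTop P, x < y →
      (∑ z : WithTop P, if x ≤ z ∧ z ≤ y then
        ((-1 : ℤ) ^ (WithTop.recTopCoe (n + 1) rk z - WithTop.recTopCoe (n + 1) rk x))
        else 0) = 0) (τ : P) :
    (-1 : ℤ) ^ (n + 1 - rk τ) +
      ∑ π : P, (if τ ≤ π then (-1 : ℤ) ^ (rk π - rk τ) else 0) = 0 := by
  have h := heul τ ⊤ (WithTop.coe_lt_top τ)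
  rw [sum_withTop] at h
  simpa using h

/-- The Eulerian relation for the upper interval `[τ, 1̂]`, as a sum over `[τ, 1̂)`. -/
theorem sum_neg_one_pow_of_eulerian {P : Type*} [Fintype P] [PartialOrder P]
    {rk : P → ℕ} {n : ℕ} (hrk : StrictMono rk) (hle : ∀ x, rk x ≤ n)
    (heul : ∀ x y : WithTop P, x < y →
      (∑ z : WithTop P, if x ≤ z ∧ z ≤ y then
        ((-1 : ℤ) ^ (WithTop.recTopCoe (n + 1) rk z - WithTop.recTopCoe (n + 1) rk x))
        else 0) = 0) (τ : P) :
    (∑ π : P, if τ ≤ π then (-1 : ℤ) ^ (n - rk π) else 0) = 1 := by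
  have h' := upper_interval_sum_of_eulerian heul τ
  have hmul : (∑ π : P, if τ ≤ π then (-1 : ℤ) ^ (n - rk π) else 0) =
      (-1) ^ (n - rk τ) * ∑ π : P, (if τ ≤ π then (-1 : ℤ) ^ (rk π - rk τ) else 0) := by
    rw [Finset.mul_sum]
    refine Finset.sum_congr rfl fun π _ => ?_
    split_ifs with hπ
    · have h1 := hrk.monotone hπ
      have h2 := hle π
      have h3 : n - rk τ = (n - rk π) + (rk π - rk τ) := by omega
      rw [h3, pow_add, mul_assoc, ← mul_pow]
      simp
    · simp
  have h4 : n + 1 - rk τ = (n - rk τ) + 1 := by have := hle τ; omega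
  rw [hmul, eq_neg_of_add_eq_zero_right h', h4, pow_succ]
  simp [← mul_pow]

section GradedPosets

variable {P : Type*} [Fintype P] [PartialOrder P]

theorem IsGradedOn.strictMono {m : P} {rk : P → ℕ} {n : ℕ}
    (h : IsGradedOn (Set.univ : Set P) m rk n) : StrictMono rk := by
  let : LocallyFiniteOrder P := Fintype.toLocallyFiniteOrder
  refine (strictMono_iff_forall_covBy rk).2 fun a b hab => ?_
  have := h.2.2.1 a trivial b trivial hab.lt fun ⟨c, _, hac, hcb⟩ => hab.2 hac hcb
  omega

theorem IsGradedOn.exists_maximal_ge {m : P} {rk : P → ℕ} {n : ℕ}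
    (h : IsGradedOn (Set.univ : Set P) m rk n) (x : P) :
    ∃ z, x ≤ z ∧ IsMax z ∧ rk z = rk m + n := by
  obtain ⟨z, hxz, hz⟩ := (Set.univ : Set P).toFinite.exists_le_maximal (Set.mem_univ x)
  have hmax : IsMax z := fun b hb => hz.2 trivial hb
  exact ⟨z, hxz, hmax, h.2.2.2 z trivial fun b _ hb => hmax.not_lt hb⟩

theorem IsGradedOn.rk_le {m : P} {rk : P → ℕ} {n : ℕ}
    (h : IsGradedOn (Set.univ : Set P) m rk n) (x : P) : rk x ≤ rk m + n := by
  obtain ⟨z, hxz, -, hz⟩ := h.exists_maximal_ge x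
  exact hz ▸ h.strictMono.monotone hxz

variable [OrderBot P]

/-- Sums over the chains of a down-closed set can be organised by the largest element of the
chain. -/
theorem sum_chainIn_eq {M : Type*} [AddCommMonoid M] {S : Set P} (hS : IsLowerSet S)
    (h : Finset P → M) :
    (∑ y : Finset P, if chainIn S ⊥ y then h y else 0) =
      ∑ σ : P, if σ ∈ S then
        (if σ = ⊥ then h {⊥} else
          ∑ y : Finset P, if chainIn {x | x < σ} ⊥ y then h (insert σ y) else 0) else 0 := by
  have h1 : ∀ y : Finset P, (if chainIn S ⊥ y then h y else 0) =
      ∑ σ : P, if chainIn S ⊥ y ∧ IsGreatest (y : Set P) σ then h y else 0 := by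
    intro y
    by_cases hy : chainIn S ⊥ y
    · obtain ⟨σ, hσ⟩ := hy.exists_isGreatest
      rw [Finset.sum_eq_single σ]
      · simp [hy, hσ]
      · intro τ _ hτ
        exact if_neg fun hc => hτ (hc.2.unique hσ)
      · simp
    · simp [hy]
  rw [Finset.sum_congr rfl fun y _ => h1 y, Finset.sum_comm]
  refine Finset.sum_congr rfl fun σ _ => ?_
  split_ifs with hσ hbot
  · subst hbot
    rw [Finset.sum_eq_single {⊥}]
    · refine if_pos ⟨⟨by simp, by simpa using hσ, by simp⟩, by simp⟩
    · intro y _ hy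
      refine if_neg fun hc => hy ?_
      ext x
      rw [Finset.mem_singleton]
      exact ⟨fun hx => le_bot_iff.1 (hc.2.2 hx), fun hx => hx ▸ hc.2.1⟩
    · simp
  · rw [← Finset.sum_filter, ← Finset.sum_filter]
    refine Finset.sum_bij' (fun y _ => y.erase σ) (fun y _ => insert σ y) ?_ ?_ ?_ ?_ ?_
    · intro y hy
      obtain ⟨⟨hb, hyS, hch⟩, hg⟩ := (Finset.mem_filter.1 hy).2
      refine Finset.mem_filter.2 ⟨Finset.mem_univ _, Finset.mem_erase.2 ⟨Ne.symm hbot, hb⟩,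
        fun x hx => ?_, hch.mono (by simp)⟩
      have hx' := Finset.mem_erase.1 (Finset.mem_coe.1 hx)
      exact lt_of_le_of_ne (hg.2 hx'.2) hx'.1
    · intro y hy
      obtain ⟨hb, hyS, hch⟩ := (Finset.mem_filter.1 hy).2
      refine Finset.mem_filter.2 ⟨Finset.mem_univ _,
        ⟨Finset.mem_insert_of_mem hb, ?_, ?_⟩, ?_, ?_⟩
      · intro x hx
        rcases Finset.mem_insert.1 (Finset.mem_coe.1 hx) with rfl | hx
        · exact hσ
        · exact hS (le_of_lt (hyS hx)) hσ
      · rw [Finset.coe_insert]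
        exact hch.insert fun x hx _ => Or.inr (hyS hx)
      · simp
      · intro x hx
        rcases Finset.mem_insert.1 (Finset.mem_coe.1 hx) with rfl | hx
        · exact le_rfl
        · exact le_of_lt (hyS hx)
    · intro y hy
      exact Finset.insert_erase (Finset.mem_filter.1 hy).2.2.1
    · intro y hy
      exact Finset.erase_insert fun hmem =>
        lt_irrefl σ ((Finset.mem_filter.1 hy).2.2.1 hmem)
    · intro y hy
      rw [Finset.insert_erase (Finset.mem_filter.1 hy).2.2.1]
  · refine Finset.sum_eq_zero fun y _ => if_neg fun hc => hσ (hc.1.2.1 hc.2.1)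

/-- The total weight of the chains ending in `σ`, up to and including the factor `b`
contributed by `σ`. -/
noncomputable def chainsTo (rk : P → ℕ) (σ : P) : NC :=
  if σ = ⊥ then 1 else absIndexOn {x | x < σ} ⊥ rk (rk σ - 1) * vb

theorem absIndexOn_eq_sum {rk : P → ℕ} (hrk : StrictMono rk) (h0 : rk ⊥ = 0) {S : Set P}
    (hS : IsLowerSet S) (n : ℕ) :
    absIndexOn S ⊥ rk n =
      ∑ σ : P, if σ ∈ S then chainsTo rk σ * (va - vb) ^ (n - rk σ) else 0 := by
  rw [absIndexOn, sum_chainIn_eq hS]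
  refine Finset.sum_congr rfl fun σ _ => if_congr Iff.rfl ?_ rfl
  rw [chainsTo]
  split_ifs with hbot
  · subst hbot
    simp [wtRanks, h0]
  · have hpos : 0 < rk σ := h0 ▸ hrk (bot_lt_iff_ne_bot.2 hbot)
    have hN : rk ⊥ + (rk σ - 1) + 1 = rk σ := by omega
    rw [absIndexOn, hN, Finset.sum_mul, Finset.sum_mul]
    refine Finset.sum_congr rfl fun y _ => ?_
    split_ifs with hy
    · rw [sort_image_insert hrk hy.2.1, wtRanks_append_singleton, h0, zero_add,
        Nat.add_sub_cancel]
      exact List.ne_nil_of_mem ((Finset.mem_sort _).2 (Finset.mem_image_of_mem rk hy.1))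
    · simp

theorem sum_chainIn_wtRanks_append {rk : P → ℕ} (h0 : rk ⊥ = 0) (S : Set P) {n : ℕ}
    (hn : 0 < n) :
    (∑ y : Finset P, if chainIn S ⊥ y then
      wtRanks (n + 1) (((y.image rk).sort (· ≤ ·)) ++ [n]) else 0) =
      absIndexOn S ⊥ rk (n - 1) * vb := by
  have hN : rk ⊥ + (n - 1) + 1 = n := by omega
  rw [absIndexOn, hN, Finset.sum_mul]
  refine Finset.sum_congr rfl fun y _ => ?_
  split_ifs with hy
  · rw [wtRanks_append_singleton]
    · simp
    · exact List.ne_nil_of_mem ((Finset.mem_sort _).2 (Finset.mem_image_of_mem rk hy.1))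
  · simp

theorem absIndexOn_lt_mul_alphaPoly {rk : P → ℕ} (hrk : StrictMono rk) (h0 : rk ⊥ = 0)
    {n : ℕ} {π : P} (hπ : π ≠ ⊥) (hn : rk π ≤ n) :
    absIndexOn {x | x < π} ⊥ rk (rk π - 1) * alphaPoly (n + 1 - rk π) =
      (∑ σ : P, if σ < π then
        (-1 : ℤ) ^ (n - rk π) •
          (chainsTo rk σ * ((va - vb) ^ (n - 1 - rk σ) * ((va - vb) + vb))) else 0) +
      chainsTo rk π * (if Even (n - rk π) then (va - vb) ^ (n - rk π)
        else -((va - vb) ^ (n - rk π - 1) * vc)) := by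
  have hk : n + 1 - rk π = (n - rk π) + 1 := by omega
  rw [hk, alphaPoly_succ, mul_add, chainsTo, if_neg hπ, mul_assoc _ vb]
  congr 1
  have hlow : IsLowerSet {x | x < π} := isLowerSet_Iio π
  rw [absIndexOn_eq_sum hrk h0 hlow, Finset.sum_mul]
  refine Finset.sum_congr rfl fun σ _ => ?_
  simp only [Set.mem_ofPred_eq]
  split_ifs with hσ
  · have := hrk hσ
    have he : n - 1 - rk σ = (rk π - 1 - rk σ) + (n - rk π) := by omega
    rw [he, pow_add, mul_smul_comm]
    simp only [mul_assoc]
  · simp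

theorem rk_bot_eq_zero_of_eulerian {rk : P → ℕ} {n : ℕ}
    (hgr : IsGradedOn (Set.univ : Set P) ⊥ rk n) (heul : ∀ x y : WithTop P, x < y →
      (∑ z : WithTop P, if x ≤ z ∧ z ≤ y then
        ((-1 : ℤ) ^ (WithTop.recTopCoe (n + 1) rk z - WithTop.recTopCoe (n + 1) rk x))
        else 0) = 0) : rk ⊥ = 0 := by
  obtain ⟨τ, -, hmax, hτ⟩ := hgr.exists_maximal_ge ⊥
  have h' := upper_interval_sum_of_eulerian heul τ
  by_contra h0
  have hz : n + 1 - rk τ = 0 := by omega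
  rw [hz, Finset.sum_eq_single τ] at h'
  · simp at h'
  · intro π _ hπ
    exact if_neg fun hle => hπ (hmax.eq_of_le hle).symm
  · simp

end GradedPosets

/-- **Theorem.** Let `Λ` be an Eulerian lattice of rank `n` and `ν > 0̂`.  The
`ab`-index of the semisuspension `Λ_ν′ = Λ_ν ∪ {*}` (the sum over chains not
containing `*`, i.e. chains of `Λ_ν`, plus the sum over chains containing `*`) is
`Ψ_{Λ_ν′} = Σ_{ν ≤ π < 1̂} Ψ_{[0̂,π)} · α_{ρ(π,1̂)}`. -/
theorem abIndex_semisuspension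
    {Λ : Type*} [Fintype Λ] [PartialOrder Λ] [OrderBot Λ]
    (rk : Λ → ℕ) (n : ℕ)
    (j : Λ → Λ → WithTop Λ)
    (hj : ∀ x y : Λ, IsLUB {(↑x : WithTop Λ), ↑y} (j x y))
    (hgr : IsGradedOn (Set.univ : Set Λ) (⊥ : Λ) rk n)
    (heul : ∀ x y : WithTop Λ, x < y →
      (∑ z : WithTop Λ, if x ≤ z ∧ z ≤ y then
        ((-1 : ℤ) ^ (WithTop.recTopCoe (n + 1) rk z - WithTop.recTopCoe (n + 1) rk x))
        else 0) = 0)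
    (ν : Λ) (hν : ⊥ < ν) :
    (absIndexOn {σ : Λ | j σ ν ≠ ⊤} (⊥ : Λ) rk n +
      ∑ y : Finset Λ,
        if chainIn {σ : Λ | j σ ν ≠ ⊤ ∧ ¬ ν ≤ σ} (⊥ : Λ) y then
          wtRanks (n + 1) (((y.image rk).sort (· ≤ ·)) ++ [n])
        else 0) =
      ∑ π : Λ, if ν ≤ π then
        absIndexOn {x : Λ | x < π} (⊥ : Λ) rk (rk π - 1) * alphaPoly (n + 1 - rk π)
      else 0 := by
  have h0 : rk ⊥ = 0 := rk_bot_eq_zero_of_eulerian hgr heul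
  have hrk : StrictMono rk := hgr.strictMono
  have hle : ∀ x, rk x ≤ n := fun x => by simpa [h0] using hgr.rk_le x
  have hn : 0 < n := lt_of_lt_of_le (h0 ▸ hrk hν) (hle ν)
  have hjub : ∀ σ π : Λ, j σ ν ≤ π ↔ σ ≤ π ∧ ν ≤ π := by
    intro σ π
    rw [isLUB_le_iff (hj σ ν)]
    simp [upperBounds]
  have hjne : ∀ σ : Λ, j σ ν ≠ ⊤ ↔ ∃ π : Λ, σ ≤ π ∧ ν ≤ π := by
    intro σ
    constructor
    · intro h
      obtain ⟨τ, hτ⟩ := WithTop.ne_top_iff_exists.1 h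
      exact ⟨τ, (hjub σ τ).1 hτ.ge⟩
    · rintro ⟨π, hπ⟩ htop
      have := (hjub σ π).2 hπ
      rw [htop] at this
      exact absurd this (not_le_of_gt (WithTop.coe_lt_top π))
  have hlow : IsLowerSet {σ : Λ | j σ ν ≠ ⊤} := by
    intro a b hba ha
    obtain ⟨π, haπ, hπ⟩ := (hjne a).1 ha
    exact (hjne b).2 ⟨π, hba.trans haπ, hπ⟩
  have hlow' : IsLowerSet {σ : Λ | j σ ν ≠ ⊤ ∧ ¬ ν ≤ σ} :=
    fun a b hba ha => ⟨hlow hba ha.1, fun hb => ha.2 (hb.trans hba)⟩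
  have hsum := sum_neg_one_pow_of_eulerian hrk hle heul
  rw [sum_chainIn_wtRanks_append h0 _ hn, absIndexOn_eq_sum hrk h0 hlow,
    absIndexOn_eq_sum hrk h0 hlow', Finset.sum_mul]
  have hR : ∀ π : Λ, (if ν ≤ π then
      absIndexOn {x : Λ | x < π} (⊥ : Λ) rk (rk π - 1) * alphaPoly (n + 1 - rk π) else 0) =
      (∑ σ : Λ, (if ν ≤ π ∧ σ < π then (-1 : ℤ) ^ (n - rk π) else 0) •
          (chainsTo rk σ * ((va - vb) ^ (n - 1 - rk σ) * ((va - vb) + vb)))) +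
      (if ν ≤ π then chainsTo rk π * (if Even (n - rk π) then (va - vb) ^ (n - rk π)
        else -((va - vb) ^ (n - rk π - 1) * vc)) else 0) := by
    intro π
    by_cases hπ : ν ≤ π
    · rw [if_pos hπ, if_pos hπ,
        absIndexOn_lt_mul_alphaPoly hrk h0 (ne_bot_of_le_ne_bot hν.ne' hπ) (hle π)]
      congr 1
      refine Finset.sum_congr rfl fun σ _ => ?_
      by_cases hσ : σ < π <;> simp [hπ, hσ]
    · simp [hπ]
  rw [Finset.sum_congr rfl fun π _ => hR π, Finset.sum_add_distrib, Finset.sum_comm,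
    ← Finset.sum_add_distrib, ← Finset.sum_add_distrib]
  refine Finset.sum_congr rfl fun σ _ => ?_
  rw [← Finset.sum_smul]
  simp only [Set.mem_ofPred_eq]
  by_cases hσ : ν ≤ σ
  · have hjσ : j σ ν ≠ ⊤ := (hjne σ).2 ⟨σ, le_rfl, hσ⟩
    have hs : (∑ π : Λ, if ν ≤ π ∧ σ < π then (-1 : ℤ) ^ (n - rk π) else 0) =
        1 - (-1) ^ (n - rk σ) := by
      rw [eq_sub_iff_add_eq]
      refine Eq.trans ?_ (hsum σ)
      have hone : (-1 : ℤ) ^ (n - rk σ) =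
          ∑ π : Λ, if π = σ then (-1 : ℤ) ^ (n - rk π) else 0 := by simp
      rw [hone, ← Finset.sum_add_distrib]
      refine Finset.sum_congr rfl fun π _ => ?_
      rcases eq_or_ne π σ with rfl | hne
      · simp
      · have : (ν ≤ π ∧ σ < π) ↔ σ ≤ π :=
          ⟨fun h => h.2.le, fun h => ⟨hσ.trans h, lt_of_le_of_ne h hne.symm⟩⟩
        simp [this, hne]
    rw [hs, if_pos hjσ, if_neg (fun h => h.2 hσ), if_pos hσ, zero_mul, add_zero]
    rcases Nat.even_or_odd (n - rk σ) with he | ho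
    · simp [he, he.neg_one_pow]
    · rw [ho.neg_one_pow, if_neg (Nat.not_even_iff_odd.2 ho)]
      obtain ⟨m, hm⟩ := ho
      have h1 : n - 1 - rk σ = 2 * m := by omega
      rw [h1, hm, Nat.add_sub_cancel, pow_succ, vc]
      noncomm_ring
  · rw [if_neg hσ, add_zero]
    by_cases hjσ : j σ ν = ⊤
    · have hs : (∑ π : Λ, if ν ≤ π ∧ σ < π then (-1 : ℤ) ^ (n - rk π) else 0) = 0 :=
        Finset.sum_eq_zero fun π _ =>
          if_neg fun h => (hjne σ).2 ⟨π, h.2.le, h.1⟩ hjσ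
      rw [hs]
      simp [hjσ]
    · obtain ⟨τ, hτ⟩ := WithTop.ne_top_iff_exists.1 hjσ
      have hs : (∑ π : Λ, if ν ≤ π ∧ σ < π then (-1 : ℤ) ^ (n - rk π) else 0) = 1 := by
        refine Eq.trans ?_ (hsum τ)
        refine Finset.sum_congr rfl fun π _ => if_congr ?_ rfl rfl
        rw [← WithTop.coe_le_coe (b := τ), hτ, hjub]
        exact ⟨fun h => ⟨h.2.le, h.1⟩,
          fun h => ⟨h.2, lt_of_le_of_ne h.1 fun he => hσ (he ▸ h.2)⟩⟩
      have hlt : rk σ < n := by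
        obtain ⟨π, hπ, hνπ⟩ := (hjne σ).1 hjσ
        exact (hrk (lt_of_le_of_ne hπ fun he => hσ (he ▸ hνπ))).trans_le (hle π)
      have h1 : n - rk σ = (n - 1 - rk σ) + 1 := by omega
      rw [hs, if_pos hjσ, if_pos ⟨hjσ, hσ⟩, one_smul, h1, pow_succ]
      simp only [mul_add, mul_assoc]
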